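/- arXiv:2501.13003 — 7 statements merged into one kernel-verified Lean document; each statement's English description precedes it below -/
import Mathlib

section
/- Let λ > 0, α > 0 and μ > 0 be real numbers with (α + 2μ) λ < 2, and let (x_l)_{l ∈ ℕ} be a real sequence satisfying x_{l+1} = (1 - (α + μ) λ) x_l + μ λ x_{l-1} for all l ≥ 1. Then there exist C ≥ 0 and ρ ∈ [0, 1) such that |x_l| ≤ C ρ^l for all l; in particular x_l → 0 as l → ∞. -/
open Filter

/-- If `λ > 0`, `α > 0`, `μ > 0`, `(α + 2μ) λ < 2` and `x` satisfies the
recurrence `x (l+1) = (1 - (α + μ) λ) x l + μ λ x (l-1)` for all `l ≥ 1`,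
then `x` decays geometrically and tends to zero. -/
theorem stmt_3 (lam α μ : ℝ) (hlam : 0 < lam) (hα : 0 < α) (hμ : 0 < μ)
    (hcond : (α + 2 * μ) * lam < 2) (x : ℕ → ℝ)
    (hrec : ∀ l : ℕ, 1 ≤ l →
      x (l + 1) = (1 - (α + μ) * lam) * x l + μ * lam * x (l - 1)) :
    (∃ C : ℝ, 0 ≤ C ∧ ∃ ρ : ℝ, 0 ≤ ρ ∧ ρ < 1 ∧ ∀ l : ℕ, |x l| ≤ C * ρ ^ l) ∧
      Tendsto x atTop (nhds 0) := by
  have hq : 0 < μ * lam := mul_pos hμ hlam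
  have hαl : 0 < α * lam := mul_pos hα hlam
  have hs : |1 - (α + μ) * lam| + μ * lam < 1 := by
    rcases abs_cases (1 - (α + μ) * lam) with ⟨h, _⟩ | ⟨h, _⟩ <;> rw [h] <;> nlinarith
  generalize 1 - (α + μ) * lam = p at hs hrec
  generalize μ * lam = q at hs hrec hq
  have hp := abs_nonneg p
  have hr0 : 0 < √(|p| + q) := Real.sqrt_pos.2 (by linarith)
  have hr1 : √(|p| + q) < 1 := by
    rw [Real.sqrt_lt' one_pos]; linarith
  have hr2 : √(|p| + q) ^ 2 = |p| + q := Real.sq_sqrt (by linarith)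
  generalize √(|p| + q) = r at hr0 hr1 hr2
  have key : ∃ C : ℝ, 0 ≤ C ∧ ∀ l : ℕ, |x l| ≤ C * r ^ l := by
    refine ⟨|x 0| + |x 1| / r, by positivity, ?_⟩
    have h0 : |x 0| ≤ |x 0| + |x 1| / r := by
      have : 0 ≤ |x 1| / r := by positivity
      linarith
    have h1 : |x 1| ≤ (|x 0| + |x 1| / r) * r := by
      rw [add_mul, div_mul_cancel₀ _ hr0.ne']
      have : 0 ≤ |x 0| * r := by positivity
      linarith
    have hC : 0 ≤ |x 0| + |x 1| / r := by positivity
    generalize |x 0| + |x 1| / r = C at h0 h1 hC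
    have step : ∀ l : ℕ, |x l| ≤ C * r ^ l ∧ |x (l + 1)| ≤ C * r ^ (l + 1) := by
      intro l
      induction l with
      | zero => simpa using ⟨h0, h1⟩
      | succ n ih =>
        refine ⟨ih.2, ?_⟩
        have hn := hrec (n + 1) (by omega)
        rw [Nat.add_sub_cancel] at hn
        rw [hn]
        have hD : 0 ≤ C * r ^ n := by positivity
        calc |p * x (n + 1) + q * x n| ≤ |p * x (n + 1)| + |q * x n| := abs_add_le _ _
          _ = |p| * |x (n + 1)| + q * |x n| := by rw [abs_mul, abs_mul, abs_of_pos hq]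
          _ ≤ |p| * (C * r ^ (n + 1)) + q * (C * r ^ n) :=
            add_le_add (mul_le_mul_of_nonneg_left ih.2 hp)
              (mul_le_mul_of_nonneg_left ih.1 hq.le)
          _ = (C * r ^ n) * (|p| * r + q) := by ring
          _ ≤ (C * r ^ n) * r ^ 2 := by
            apply mul_le_mul_of_nonneg_left _ hD
            rw [hr2]
            nlinarith
          _ = C * r ^ (n + 1 + 1) := by ring
    exact fun l => (step l).1
  obtain ⟨C, hC, h⟩ := key
  refine ⟨⟨C, hC, r, hr0.le, hr1, h⟩, ?_⟩
  apply squeeze_zero_norm (a := fun l => C * r ^ l) h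
  simpa using (tendsto_pow_atTop_nhds_zero_of_lt_one hr0.le hr1).const_mul C
end

section
/- Let L be a real symmetric n×n matrix and let c, d be real numbers. A complex number z is an eigenvalue (over ℂ) of the real 2n×2n block matrix M = [[I_n - c L, d L], [I_n, 0]] if and only if there exists a real eigenvalue λ of L such that z^2 - (1 - c λ) z - d λ = 0. -/
open Matrix

theorem spec_map_aux {n : ℕ} (L : Matrix (Fin n) (Fin n) ℝ) (r : ℝ) :
    (r : ℂ) ∈ spectrum ℂ (L.map (algebraMap ℝ ℂ)) ↔ r ∈ spectrum ℝ L := by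
  rw [spectrum.mem_iff, spectrum.mem_iff, not_iff_not, Matrix.isUnit_iff_isUnit_det,
    Matrix.isUnit_iff_isUnit_det]
  have h : algebraMap ℂ (Matrix (Fin n) (Fin n) ℂ) (r : ℂ) - L.map (algebraMap ℝ ℂ)
      = (algebraMap ℝ ℂ).mapMatrix (algebraMap ℝ (Matrix (Fin n) (Fin n) ℝ) r - L) := by
    ext i j
    by_cases hij : i = j <;> simp [Matrix.algebraMap_matrix_apply, hij]
  rw [h, ← RingHom.map_det]
  simp

theorem block_aux {n : ℕ} (L : Matrix (Fin n) (Fin n) ℝ) (c d : ℝ) (z : ℂ) :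
    z ∈ spectrum ℂ
        ((Matrix.fromBlocks (1 - c • L) (d • L) (1 : Matrix (Fin n) (Fin n) ℝ)
            (0 : Matrix (Fin n) (Fin n) ℝ)).map (algebraMap ℝ ℂ)) ↔
    (0 : ℂ) ∈ spectrum ℂ ((z ^ 2 - z) • (1 : Matrix (Fin n) (Fin n) ℂ)
      + (c * z - d) • L.map (algebraMap ℝ ℂ)) := by
  rw [spectrum.zero_mem_iff, spectrum.mem_iff, not_iff_not]
  set A := L.map (algebraMap ℝ ℂ) with hA
  have hM : algebraMap ℂ (Matrix (Fin n ⊕ Fin n) (Fin n ⊕ Fin n) ℂ) z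
      - (Matrix.fromBlocks (1 - c • L) (d • L) (1 : Matrix (Fin n) (Fin n) ℝ)
            (0 : Matrix (Fin n) (Fin n) ℝ)).map (algebraMap ℝ ℂ)
      = Matrix.fromBlocks ((z - 1) • (1 : Matrix (Fin n) (Fin n) ℂ) + (c : ℂ) • A) (-((d : ℂ) • A)) (-1) (z • (1 : Matrix (Fin n) (Fin n) ℂ)) := by
    ext i j
    rcases i with i | i <;> rcases j with j | j <;> by_cases hij : i = j <;>
      simp [Matrix.algebraMap_matrix_apply, hij, hA] <;> ring
  have hU : IsUnit (Matrix.fromBlocks (z • 1) 1 1 0 :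
      Matrix (Fin n ⊕ Fin n) (Fin n ⊕ Fin n) ℂ) := by
    have h1 : (Matrix.fromBlocks (z • 1) 1 1 0 : Matrix (Fin n ⊕ Fin n) (Fin n ⊕ Fin n) ℂ)
      * Matrix.fromBlocks 0 1 1 (-(z • (1 : Matrix (Fin n) (Fin n) ℂ))) = 1 := by
      rw [Matrix.fromBlocks_multiply, ← Matrix.fromBlocks_one]; simp
    exact IsUnit.of_mul_eq_one _ h1
  have hP : Matrix.fromBlocks ((z - 1) • (1 : Matrix (Fin n) (Fin n) ℂ) + (c : ℂ) • A) (-((d : ℂ) • A)) (-1) (z • (1 : Matrix (Fin n) (Fin n) ℂ))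
      * (Matrix.fromBlocks (z • 1) 1 1 0 : Matrix (Fin n ⊕ Fin n) (Fin n ⊕ Fin n) ℂ)
      = Matrix.fromBlocks ((z ^ 2 - z) • 1 + ((c : ℂ) * z - d) • A)
          ((z - 1) • (1 : Matrix (Fin n) (Fin n) ℂ) + (c : ℂ) • A) 0 (-1) := by
    rw [Matrix.fromBlocks_multiply]
    congr 1
    · simp only [mul_smul_comm, mul_one]
      module
    · simp
    · simp
    · simp
  rw [hM, ← hU.mul_right_iff, hP, Matrix.isUnit_fromBlocks_zero₂₁]
  simp

/-- For a real symmetric matrix `L` and reals `c`, `d`, a complex number `z`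
is an eigenvalue of the block companion matrix
`M = [[I - c L, d L], [I, 0]]` if and only if there is a real eigenvalue `λ`
of `L` with `z^2 - (1 - c λ) z - d λ = 0`. -/
theorem stmt_4 (n : ℕ) (L : Matrix (Fin n) (Fin n) ℝ) (hL : L.IsSymm)
    (c d : ℝ) (z : ℂ) :
    z ∈ spectrum ℂ
        ((Matrix.fromBlocks (1 - c • L) (d • L) (1 : Matrix (Fin n) (Fin n) ℝ)
            (0 : Matrix (Fin n) (Fin n) ℝ)).map (algebraMap ℝ ℂ)) ↔
      ∃ lam : ℝ, lam ∈ spectrum ℝ L ∧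
        z ^ 2 - (1 - (c : ℂ) * lam) * z - (d : ℂ) * lam = 0 := by
  rw [block_aux]
  rcases Nat.eq_zero_or_pos n with rfl | hn
  · simp [spectrum.of_subsingleton]
  have : NeZero n := ⟨hn.ne'⟩
  have hH : (L.map (algebraMap ℝ ℂ)).IsHermitian := by
    ext i j
    simp [Matrix.conjTranspose_apply, hL.apply i j]
  set A := L.map (algebraMap ℝ ℂ) with hA
  have hp : (z ^ 2 - z) • (1 : Matrix (Fin n) (Fin n) ℂ) + (c * z - d) • A
      = Polynomial.aeval A (Polynomial.C (z ^ 2 - z)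
        + Polynomial.C ((c : ℂ) * z - d) * Polynomial.X) := by
    rw [map_add, map_mul, Polynomial.aeval_C, Polynomial.aeval_C, Polynomial.aeval_X,
      Algebra.algebraMap_eq_smul_one, Algebra.algebraMap_eq_smul_one, smul_one_mul]
  rw [hp, spectrum.map_polynomial_aeval_of_nonempty _ _
    (spectrum.nonempty_of_isAlgClosed_of_finiteDimensional ℂ A)]
  constructor
  · rintro ⟨w, hw, h0⟩
    have hw' := hw
    rw [hH.spectrum_eq_image_range] at hw'
    obtain ⟨r, -, rfl⟩ := hw'
    refine ⟨r, (spec_map_aux L r).1 hw, ?_⟩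
    simp at h0
    linear_combination h0
  · rintro ⟨r, hr, h0⟩
    refine ⟨r, (spec_map_aux L r).2 hr, ?_⟩
    simp
    linear_combination h0
end

section
/- Let G be a finite simple connected graph on vertex set {1, …, N} with N ≥ 2 and Laplacian matrix L, and let λ_max be the largest eigenvalue of L. Let α be a real number with 0 < α < 2/(3 λ_max). For each node i let Ω_i be a real symmetric n×n matrix. Define matrix-valued sequences ν_{i,l} and Θ_{i,l} (l ∈ ℕ, each a symmetric n×n real matrix) by ν_{i,0} = 0, Θ_{i,0} arbitrary symmetric, and for l ≥ 0: ν_{i,l+1} = ν_{i,l} + α Σ_j L_{ij} Θ_{j,l} and Θ_{i,l+1} = N Ω_i - ν_{i,l+1} - α Σ_j L_{ij} Θ_{j,l}. Then for every node i, Θ_{i,l} converges to Σ_{j=1}^N Ω_j as l → ∞. -/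
open Matrix Filter

theorem aux_rec (m : ℝ) (h0 : 0 < m) (h1 : m < 2 / 3) (t : ℕ → ℝ)
    (ht : ∀ l, t (l + 2) = (1 - 2 * m) * t (l + 1) + m * t l) :
    Tendsto t atTop (nhds 0) := by
  have hD : 0 < 1 + 4 * m ^ 2 := by positivity
  set q := Real.sqrt (1 + 4 * m ^ 2) with hq
  have hq2 : q ^ 2 = 1 + 4 * m ^ 2 := Real.sq_sqrt hD.le
  have hq0 : 0 < q := Real.sqrt_pos.mpr hD
  have hqa : q < 1 + 2 * m := by nlinarith
  have hqb : q < 3 - 2 * m := by nlinarith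
  have key : ∀ r s : ℝ, r + s = 1 - 2 * m → r * s = -m → |s| < 1 →
      Tendsto (fun l => t (l + 1) - r * t l) atTop (nhds 0) := by
    intro r s hrs hp hs
    have e : ∀ l, t (l + 1) - r * t l = s ^ l * (t 1 - r * t 0) := by
      intro l
      induction l with
      | zero => simp
      | succ k ih =>
        rw [pow_succ, mul_right_comm, ← ih, ht]
        linear_combination (-t (k + 1)) * hrs + t k * hp
    rw [funext e]
    simpa using (tendsto_pow_atTop_nhds_zero_of_abs_lt_one hs).mul_const (t 1 - r * t 0)
  have A := key ((1 - 2 * m + q) / 2) ((1 - 2 * m - q) / 2) (by ring)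
    (by linear_combination (-1 / 4) * hq2) (by rw [abs_lt]; constructor <;> linarith)
  have B := key ((1 - 2 * m - q) / 2) ((1 - 2 * m + q) / 2) (by ring)
    (by linear_combination (-1 / 4) * hq2) (by rw [abs_lt]; constructor <;> linarith)
  have C := (B.sub A).div_const q
  simp only [sub_zero, zero_div] at C
  refine C.congr fun l => ?_
  field_simp
  ring

theorem aux_vec (N : ℕ) (G : SimpleGraph (Fin N))
    [DecidableRel G.Adj] (hconn : G.Connected) (lmax : ℝ)
    (hlmax : IsGreatest (spectrum ℝ (G.lapMatrix ℝ)) lmax)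
    (α : ℝ) (hα0 : 0 < α) (hα1 : α < 2 / (3 * lmax))
    (w : Fin N → ℝ) (ν θ : ℕ → Fin N → ℝ) (hν0 : ν 0 = 0)
    (hν : ∀ l, ν (l + 1) = ν l + α • (G.lapMatrix ℝ *ᵥ θ l))
    (hθ : ∀ l, θ (l + 1) = (N : ℝ) • w - ν (l + 1) - α • (G.lapMatrix ℝ *ᵥ θ l)) (i : Fin N) :
    Tendsto (fun l => θ l i) atTop (nhds (∑ j, w j)) := by
  have hpsd := G.posSemidef_lapMatrix ℝ
  have hH := hpsd.isHermitian
  have hl0 : 0 < lmax := by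
    by_contra hc
    have : 2 / (3 * lmax) ≤ 0 := div_nonpos_of_nonneg_of_nonpos (by norm_num) (by linarith)
    linarith
  have hαl : α * lmax < 2 / 3 := by
    rw [lt_div_iff₀ (by positivity)] at hα1
    linarith
  set p : Fin N → ℝ := fun _ => ∑ j, w j with hp
  have hLp : G.lapMatrix ℝ *ᵥ p = 0 := by
    rw [G.lapMatrix_mulVec_eq_zero_iff_forall_reachable]
    intros; rfl
  -- coefficients along eigenvectors
  have main : ∀ (u : Fin N → ℝ) (μ : ℝ), G.lapMatrix ℝ *ᵥ u = μ • u → 0 ≤ μ → μ ≤ lmax →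
      Tendsto (fun l => u ⬝ᵥ (θ l - p)) atTop (nhds 0) := by
    intro u μ hu h0 h1
    have hL : ∀ x : Fin N → ℝ, u ⬝ᵥ (G.lapMatrix ℝ *ᵥ x) = μ * (u ⬝ᵥ x) := by
      intro x
      rw [Matrix.dotProduct_mulVec, ← Matrix.mulVec_transpose,
        (G.isSymm_lapMatrix (R := ℝ)).eq, hu, smul_dotProduct, smul_eq_mul]
    have hv : ∀ l, u ⬝ᵥ ν (l + 1) = u ⬝ᵥ ν l + α * (μ * (u ⬝ᵥ θ l)) := by
      intro l
      rw [hν, dotProduct_add, dotProduct_smul, hL, smul_eq_mul]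
    have ht : ∀ l, u ⬝ᵥ θ (l + 1) = N * (u ⬝ᵥ w) - u ⬝ᵥ ν (l + 1) - α * (μ * (u ⬝ᵥ θ l)) := by
      intro l
      rw [hθ, dotProduct_sub, dotProduct_sub, dotProduct_smul, dotProduct_smul, hL, smul_eq_mul,
        smul_eq_mul]
    rcases h0.eq_or_lt with h | h
    · subst h
      have hv0 : ∀ l, u ⬝ᵥ ν l = 0 := by
        intro l
        induction l with
        | zero => simp [hν0]
        | succ k ih => rw [hv, ih]; ring
      have huc : ∀ j, u j = u i := by
        rw [zero_smul, G.lapMatrix_mulVec_eq_zero_iff_forall_reachable] at hu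
        exact fun j => hu j i (hconn.preconnected j i)
      have hz : ∀ l, u ⬝ᵥ (θ (l + 1) - p) = 0 := by
        intro l
        rw [dotProduct_sub, ht, hv0]
        simp only [dotProduct, huc, hp, Finset.sum_const, ← Finset.mul_sum]
        simp
      rw [← tendsto_add_atTop_iff_nat 1]
      simp_rw [hz]
      exact tendsto_const_nhds
    · have hup : u ⬝ᵥ p = 0 := by
        have := hL p
        rw [hLp, dotProduct_zero] at this
        rcases mul_eq_zero.mp this.symm with h' | h'
        · exact absurd h' h.ne'
        · exact h'
      simp_rw [dotProduct_sub, hup, sub_zero]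
      refine aux_rec (α * μ) (by positivity) (by nlinarith) _ fun l => ?_
      have a := ht (l + 1)
      have b := ht l
      have c := hv (l + 1)
      linear_combination a - b - c
  have hfin : Tendsto (fun l => θ l i - p i) atTop (nhds 0) := by
    have e : ∀ l, θ l i - p i =
        ∑ k, ((hH.eigenvectorBasis k).ofLp ⬝ᵥ (θ l - p)) * (hH.eigenvectorBasis k).ofLp i := by
      intro l
      have := congrArg (fun x : EuclideanSpace ℝ (Fin N) => x i)
        (hH.eigenvectorBasis.sum_repr' (WithLp.toLp 2 (θ l - p)))
      simp only [WithLp.ofLp_sum, WithLp.ofLp_smul, Finset.sum_apply, Pi.smul_apply, smul_eq_mul,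
        EuclideanSpace.inner_eq_star_dotProduct, star_trivial, Pi.sub_apply] at this
      rw [← this]
      exact Finset.sum_congr rfl fun k _ => by rw [dotProduct_comm]
    simp_rw [e]
    have : (0 : ℝ) = ∑ k : Fin N, 0 * (hH.eigenvectorBasis k).ofLp i := by simp
    rw [this]
    refine tendsto_finsetSum _ fun k _ => Tendsto.mul_const _ ?_
    exact main _ (hH.eigenvalues k) (hH.mulVec_eigenvectorBasis k) (hpsd.eigenvalues_nonneg k)
      (hlmax.2 (hH.eigenvalues_mem_spectrum_real k))
  simpa using hfin.add_const (p i)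

/-- Matrix form of Theorem 1: the covariance-consensus ADMM iterates `Θ i l`
converge to the global information rate matrix `∑ j, Ω j` whenever
`0 < α < 2 / (3 λ_max(L))`. -/
theorem stmt_5 (N n : ℕ) (hN : 2 ≤ N) (G : SimpleGraph (Fin N))
    [DecidableRel G.Adj] (hconn : G.Connected) (lmax : ℝ)
    (hlmax : IsGreatest (spectrum ℝ (G.lapMatrix ℝ)) lmax)
    (α : ℝ) (hα0 : 0 < α) (hα1 : α < 2 / (3 * lmax))
    (Ω : Fin N → Matrix (Fin n) (Fin n) ℝ) (hΩ : ∀ i, (Ω i).IsSymm)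
    (ν Θ : ℕ → Fin N → Matrix (Fin n) (Fin n) ℝ)
    (hν0 : ∀ i, ν 0 i = 0) (hΘ0 : ∀ i, (Θ 0 i).IsSymm)
    (hν : ∀ (l : ℕ) (i : Fin N),
      ν (l + 1) i = ν l i + α • ∑ j, G.lapMatrix ℝ i j • Θ l j)
    (hΘ : ∀ (l : ℕ) (i : Fin N),
      Θ (l + 1) i = (N : ℝ) • Ω i - ν (l + 1) i
        - α • ∑ j, G.lapMatrix ℝ i j • Θ l j) :
    ∀ i : Fin N, Tendsto (fun l => Θ l i) atTop (nhds (∑ j, Ω j)) := by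
  intro i
  refine tendsto_pi_nhds.mpr fun a => tendsto_pi_nhds.mpr fun b => ?_
  have := aux_vec N G hconn lmax hlmax α hα0 hα1 (fun j => Ω j a b) (fun l j => ν l j a b)
    (fun l j => Θ l j a b) (by funext j; simp [hν0])
    (by
      intro l; funext j
      simp [hν, Matrix.sum_apply, mulVec, dotProduct])
    (by
      intro l; funext j
      simp [hΘ, Matrix.sum_apply, mulVec, dotProduct]) i
  simpa [Matrix.sum_apply] using this
end

section
/- Let G be a finite simple connected graph on vertex set {1, …, N} with N ≥ 2 and Laplacian matrix L, and let λ_max be the largest eigenvalue of L. Let α be a real number with 0 < α < 2/(3 λ_max), let d ≥ 1, and for each node i let ω_i ∈ ℝ^d. Define sequences ν_{i,t}, θ_{i,t} ∈ ℝ^d (t ∈ ℕ) by ν_{i,0} = 0, θ_{i,0} arbitrary, and for t ≥ 0: ν_{i,t+1} = ν_{i,t} + α Σ_j L_{ij} θ_{j,t} and θ_{i,t+1} = N ω_i - ν_{i,t+1} - α Σ_j L_{ij} θ_{j,t}. Then for every node i, θ_{i,t} converges to Σ_{j=1}^N ω_j as t → ∞. -/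
open Matrix Filter

theorem aux_rec_s6 {E : Type*} [NormedAddCommGroup E] [NormedSpace ℝ E] (a : ℝ) (ha0 : 0 < a)
    (ha1 : a < 2 / 3) (x : ℕ → E)
    (hx : ∀ t, x (t + 2) = (1 - 2 * a) • x (t + 1) + a • x t) :
    Tendsto x atTop (nhds 0) := by
  obtain ⟨q, hq⟩ : ∃ q, q = Real.sqrt (1 + 4 * a ^ 2) := ⟨_, rfl⟩
  have hq2 : q ^ 2 = 1 + 4 * a ^ 2 := by rw [hq]; exact Real.sq_sqrt (by positivity)
  have hq0 : 0 < q := by rw [hq]; positivity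
  obtain ⟨r, hr⟩ : ∃ r, r = (1 - 2 * a + q) / 2 := ⟨_, rfl⟩
  obtain ⟨s, hs⟩ : ∃ s, s = (1 - 2 * a - q) / 2 := ⟨_, rfl⟩
  have hsum : 1 - 2 * a = r + s := by rw [hr, hs]; ring
  have hprod : a = - (r * s) := by rw [hr, hs]; nlinarith
  have hq1 : q < 1 + 2 * a := by nlinarith
  have hq3 : q < 3 - 2 * a := by nlinarith
  have hr1 : |r| < 1 := by rw [abs_lt]; constructor <;> linarith
  have hs1 : |s| < 1 := by rw [abs_lt]; constructor <;> linarith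
  have key : ∀ r s : ℝ, 1 - 2 * a = r + s → a = -(r * s) →
      ∀ t, x (t + 1) - r • x t = s ^ t • (x 1 - r • x 0) := by
    intro r s h1 h2 t
    induction t with
    | zero => simp
    | succ n ih =>
      rw [pow_succ', mul_smul, ← ih, hx, h1]
      nth_rewrite 1 [h2]
      module
  have k1 := key r s hsum hprod
  have k2 := key s r (by rw [hsum]; ring) (by rw [hprod]; ring)
  have hx' : ∀ t, x t = q⁻¹ • (r ^ t • (x 1 - s • x 0) - s ^ t • (x 1 - r • x 0)) := by
    intro t
    rw [← k1, ← k2, eq_inv_smul_iff₀ hq0.ne']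
    have : q = r - s := by rw [hr, hs]; ring
    rw [this]; module
  rw [funext hx']
  have := (((tendsto_pow_atTop_nhds_zero_of_abs_lt_one hr1).smul_const (x 1 - s • x 0)).sub
    ((tendsto_pow_atTop_nhds_zero_of_abs_lt_one hs1).smul_const (x 1 - r • x 0))).const_smul q⁻¹
  simpa using this

/-- Corollary 1: the covariance-consensus ADMM update without sub-iterations,
`ν (t+1) i = ν t i + α ∑ j L i j • θ t j`,
`θ (t+1) i = N ω i - ν (t+1) i - α ∑ j L i j • θ t j`,
converges at every node to `∑ j, ω j` whenever `0 < α < 2 / (3 λ_max(L))`. -/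
theorem stmt_6 (N d : ℕ) (hN : 2 ≤ N) (hd : 1 ≤ d) (G : SimpleGraph (Fin N))
    [DecidableRel G.Adj] (hconn : G.Connected) (lmax : ℝ)
    (hlmax : IsGreatest (spectrum ℝ (G.lapMatrix ℝ)) lmax)
    (α : ℝ) (hα0 : 0 < α) (hα1 : α < 2 / (3 * lmax))
    (ω : Fin N → EuclideanSpace ℝ (Fin d))
    (ν θ : ℕ → Fin N → EuclideanSpace ℝ (Fin d))
    (hν0 : ∀ i, ν 0 i = 0)
    (hν : ∀ (t : ℕ) (i : Fin N),
      ν (t + 1) i = ν t i + α • ∑ j, G.lapMatrix ℝ i j • θ t j)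
    (hθ : ∀ (t : ℕ) (i : Fin N),
      θ (t + 1) i = (N : ℝ) • ω i - ν (t + 1) i
        - α • ∑ j, G.lapMatrix ℝ i j • θ t j) :
    ∀ i : Fin N, Tendsto (fun t => θ t i) atTop (nhds (∑ j, ω j)) := by
  classical
  have hH : (G.lapMatrix ℝ).IsHermitian := (G.posSemidef_lapMatrix ℝ).1
  have hsym : ∀ i j, G.lapMatrix ℝ i j = G.lapMatrix ℝ j i := fun i j =>
    (congrFun (congrFun (G.isSymm_lapMatrix (R := ℝ)) i) j).symm
  obtain ⟨S, hS⟩ : ∃ S, S = ∑ j, ω j := ⟨_, rfl⟩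
  obtain ⟨b, hb⟩ : ∃ b : Fin N → Fin N → ℝ, ∀ k i, b k i = hH.eigenvectorBasis k i :=
    ⟨fun k i => hH.eigenvectorBasis k i, fun _ _ => rfl⟩
  obtain ⟨l, hl⟩ : ∃ l : Fin N → ℝ, l = hH.eigenvalues := ⟨_, rfl⟩
  have hN0 : (N : ℝ) ≠ 0 := by positivity
  have hlm : 0 < lmax := by
    by_contra h
    have : 2 / (3 * lmax) ≤ 0 := div_nonpos_of_nonneg_of_nonpos (by norm_num) (by linarith)
    linarith
  have hl0 : ∀ k, 0 ≤ l k := fun k => by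
    rw [hl]; exact (G.posSemidef_lapMatrix ℝ).eigenvalues_nonneg k
  have hl1 : ∀ k, α * l k < 2 / 3 := fun k => by
    have h1 : l k ≤ lmax := by rw [hl]; exact hlmax.2 (hH.eigenvalues_mem_spectrum_real k)
    rw [lt_div_iff₀ (by positivity)] at hα1
    nlinarith
  have heig : ∀ k i, ∑ j, G.lapMatrix ℝ i j * b k j = l k * b k i := by
    intro k i
    have := congrFun (hH.mulVec_eigenvectorBasis k) i
    simpa [mulVec, dotProduct, hb, hl] using this
  have horth : ∀ i j, ∑ k, b k i * b k j = if i = j then 1 else 0 := by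
    intro i j
    have h := Unitary.coe_mul_star_self hH.eigenvectorUnitary
    have := congrFun (congrFun h i) j
    simpa [mul_apply, hb, one_apply, hH.eigenvectorUnitary_apply] using this
  have hbsum : ∀ k, l k * ∑ i, b k i = 0 := by
    intro k
    rw [Finset.mul_sum]
    simp_rw [← heig]
    rw [Finset.sum_comm]
    refine Finset.sum_eq_zero fun j _ => ?_
    rw [← Finset.sum_mul]
    have := congrFun (G.lapMatrix_mulVec_const_eq_zero (R := ℝ)) j
    simp only [mulVec, dotProduct, mul_one, Pi.zero_apply] at this
    simp_rw [hsym _ j]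
    rw [this, zero_mul]
  have hbconst : ∀ k, l k = 0 → ∀ i j, b k i = b k j := by
    intro k hk i j
    have h0 : G.lapMatrix ℝ *ᵥ (b k) = 0 := by
      funext i
      have := heig k i
      simpa [mulVec, dotProduct, hk] using this
    exact (G.lapMatrix_mulVec_eq_zero_iff_forall_reachable.1 h0) i j (hconn.preconnected i j)
  obtain ⟨P, hP⟩ : ∃ P : Fin N → (Fin N → EuclideanSpace ℝ (Fin d)) → EuclideanSpace ℝ (Fin d),
    ∀ k f, P k f = ∑ j, b k j • f j := ⟨fun k f => ∑ j, b k j • f j, fun _ _ => rfl⟩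
  have hPL : ∀ k f, ∑ i, b k i • (∑ j, G.lapMatrix ℝ i j • f j) = l k • P k f := by
    intro k f
    simp_rw [hP, Finset.smul_sum, smul_smul]
    rw [Finset.sum_comm]
    refine Finset.sum_congr rfl fun j _ => ?_
    rw [← Finset.sum_smul, ← heig]
    congr 1
    refine Finset.sum_congr rfl fun i _ => ?_
    rw [hsym j i, mul_comm]
  have hPν : ∀ k t, P k (ν (t + 1)) = P k (ν t) + (α * l k) • P k (θ t) := by
    intro k t
    rw [mul_smul, ← hPL, hP, hP, Finset.smul_sum, ← Finset.sum_add_distrib]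
    refine Finset.sum_congr rfl fun i _ => ?_
    rw [hν, smul_add, smul_comm]
  have hPθ : ∀ k t, P k (θ (t + 1)) =
      (N : ℝ) • P k ω - P k (ν (t + 1)) - (α * l k) • P k (θ t) := by
    intro k t
    rw [mul_smul, ← hPL, hP, hP, hP, Finset.smul_sum, Finset.smul_sum, ← Finset.sum_sub_distrib,
      ← Finset.sum_sub_distrib]
    refine Finset.sum_congr rfl fun i _ => ?_
    rw [hθ, smul_sub, smul_sub, smul_comm α, smul_comm (N : ℝ)]
  have hPlim : ∀ k, Tendsto (fun t => P k (θ t)) atTop (nhds ((∑ j, b k j) • S)) := by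
    intro k
    rcases (hl0 k).eq_or_lt with h | h
    · have h := h.symm
      have hν' : ∀ t, P k (ν t) = 0 := by
        intro t
        induction t with
        | zero => simp [hP, hν0]
        | succ n ih => rw [hPν, ih, h]; simp
      have hc : ∀ t, P k (θ (t + 1)) = (∑ j, b k j) • S := by
        intro t
        rw [hPθ, hν', h, hP, hS]
        have i0 : Fin N := ⟨0, by omega⟩
        simp_rw [fun j => hbconst k h j i0]
        rw [← Finset.smul_sum]
        simp [smul_smul]
      rw [← tendsto_add_atTop_iff_nat 1]
      simp_rw [hc]
      exact tendsto_const_nhds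
    · have h0 : ∑ j, b k j = 0 := (mul_eq_zero.1 (hbsum k)).resolve_left h.ne'
      rw [h0, zero_smul, ← tendsto_add_atTop_iff_nat 1]
      refine aux_rec_s6 (α * l k) (by positivity) (hl1 k) _ fun t => ?_
      have e1 := hPθ k (t + 1 + 1)
      have e2 := hPθ k (t + 1)
      have e3 := hPν k (t + 1 + 1)
      have e4 : P k (ν (t + 1 + 1)) =
          (N : ℝ) • P k ω - P k (θ (t + 1 + 1)) - (α * l k) • P k (θ (t + 1)) := by
        rw [e2]; abel
      change P k (θ (t + 1 + 1 + 1)) = (1 - 2 * (α * l k)) • P k (θ (t + 1 + 1))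
        + (α * l k) • P k (θ (t + 1))
      rw [e1, e3, e4]
      module
  intro i
  rw [← hS]
  have hrec : ∀ f : Fin N → EuclideanSpace ℝ (Fin d), f i = ∑ k, b k i • P k f := by
    intro f
    simp_rw [hP, Finset.smul_sum, smul_smul]
    rw [Finset.sum_comm]
    simp_rw [← Finset.sum_smul, horth]
    simp
  have e : ∀ t, θ t i = ∑ k, b k i • P k (θ t) := fun t => hrec _
  have e' : S = ∑ k, b k i • ((∑ j, b k j) • S) := by
    have := hrec (fun _ => S)
    simp_rw [hP, ← Finset.sum_smul] at this
    exact this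
  rw [e']
  simp_rw [e]
  exact tendsto_finsetSum _ fun k _ => (hPlim k).const_smul _
end

section
/- Let G be a finite simple connected graph on vertex set {1, …, N} with N ≥ 2 and Laplacian matrix L, let n ≥ 1, set 𝕃 = L ⊗ I_n (an Nn×Nn real symmetric positive semidefinite matrix), let √𝕃 denote its positive semidefinite square root, and let 𝟙 = 1_N ⊗ I_n (the Nn×n matrix stacking N copies of I_n). Let 𝐆 be a real symmetric positive definite Nn×Nn matrix, μ ≥ 0 a real number, and b ∈ ℝ^{Nn}. If ξ ∈ ℝ^{Nn} and λ ∈ ℝ^{Nn} satisfy the KKT system (𝐆 + μ𝕃) ξ + √𝕃 λ = b and √𝕃 ξ = 0, then the n×n matrix 𝟙^⊤ 𝐆 𝟙 is positive definite (hence invertible) and ξ = 𝟙 (𝟙^⊤ 𝐆 𝟙)^{-1} 𝟙^⊤ b. -/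
open Matrix Kronecker

/-- Primal part of Lemma 1: if `(G + μ𝕃) ξ + √𝕃 λ = b` and `√𝕃 ξ = 0`, where
`𝕃 = L ⊗ I_n` for the Laplacian `L` of a connected graph and `√𝕃 = S` is the
PSD square root of `𝕃`, then `Jᵀ G J` is positive definite and
`ξ = J (Jᵀ G J)⁻¹ Jᵀ b`, where `J = 1_N ⊗ I_n`. -/
theorem stmt_9 (N n : ℕ) (hN : 2 ≤ N) (hn : 1 ≤ n) (G : SimpleGraph (Fin N))
    [DecidableRel G.Adj] (hconn : G.Connected)
    (S : Matrix (Fin N × Fin n) (Fin N × Fin n) ℝ)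
    (hSpsd : S.PosSemidef)
    (hSsq : S * S = G.lapMatrix ℝ ⊗ₖ (1 : Matrix (Fin n) (Fin n) ℝ))
    (Gq : Matrix (Fin N × Fin n) (Fin N × Fin n) ℝ) (hGq : Gq.PosDef)
    (μ : ℝ) (hμ : 0 ≤ μ) (b : Fin N × Fin n → ℝ)
    (ξ lam : Fin N × Fin n → ℝ)
    (hKKT1 : (Gq + μ • (G.lapMatrix ℝ ⊗ₖ (1 : Matrix (Fin n) (Fin n) ℝ))).mulVec ξ
        + S.mulVec lam = b)
    (hKKT2 : S.mulVec ξ = 0)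
    (J : Matrix (Fin N × Fin n) (Fin n) ℝ)
    (hJ : J = Matrix.of fun p j => if p.2 = j then (1 : ℝ) else 0) :
    (Jᵀ * Gq * J).PosDef ∧
      ξ = J.mulVec ((Jᵀ * Gq * J)⁻¹.mulVec (Jᵀ.mulVec b)) := by
  have hK : ∀ (x : Fin N × Fin n → ℝ) (i : Fin N) (k : Fin n),
      ((G.lapMatrix ℝ ⊗ₖ (1 : Matrix (Fin n) (Fin n) ℝ)).mulVec x) (i, k)
        = ((G.lapMatrix ℝ).mulVec (fun j => x (j, k))) i := by
    intro x i k
    simp [Matrix.mulVec, dotProduct, Fintype.sum_prod_type, Matrix.one_apply]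
  have hJv : ∀ (y : Fin n → ℝ) (p : Fin N × Fin n), (J.mulVec y) p = y p.2 := by
    intro y p
    simp [hJ, Matrix.mulVec, dotProduct]
  let i0 : Fin N := ⟨0, by omega⟩
  have hinj : Function.Injective J.mulVec := by
    intro y z h
    funext k
    have := congrFun h (i0, k)
    simpa [hJv] using this
  have hT : Jᴴ = Jᵀ := by ext; simp
  have hPD : (Jᵀ * Gq * J).PosDef := by
    rw [← hT]
    exact hGq.conjTranspose_mul_mul_same hinj
  refine ⟨hPD, ?_⟩
  have hKxi : (G.lapMatrix ℝ ⊗ₖ (1 : Matrix (Fin n) (Fin n) ℝ)).mulVec ξ = 0 := by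
    rw [← hSsq, ← Matrix.mulVec_mulVec, hKKT2, Matrix.mulVec_zero]
  obtain ⟨x, hx⟩ : ∃ x : Fin n → ℝ, ξ = J.mulVec x := by
    refine ⟨fun k => ξ (i0, k), ?_⟩
    funext p
    rw [hJv]
    have h0 : (G.lapMatrix ℝ).mulVec (fun j => ξ (j, p.2)) = 0 := by
      funext i
      rw [← hK, hKxi]
      rfl
    exact (G.lapMatrix_mulVec_eq_zero_iff_forall_reachable.mp h0) p.1 i0 (hconn.preconnected _ _)
  have hSh : Sᴴ = S := hSpsd.isHermitian
  have hSJ : S * J = 0 := by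
    rw [← Matrix.conjTranspose_mul_self_mul_eq_zero, hSh, hSsq]
    apply Matrix.ext_of_mulVec_single
    intro k
    rw [← Matrix.mulVec_mulVec, Matrix.zero_mulVec]
    funext p
    obtain ⟨i, l⟩ := p
    rw [hK]
    simp only [hJv]
    exact congrFun (G.lapMatrix_mulVec_eq_zero_iff_forall_reachable.mpr
      (fun _ _ _ => rfl)) i
  have hJS : Jᵀ * S = 0 := by
    have := congrArg Matrix.conjTranspose hSJ
    rwa [Matrix.conjTranspose_mul, hSh, hT, Matrix.conjTranspose_zero] at this
  have hb : Jᵀ.mulVec b = (Jᵀ * Gq * J).mulVec x := by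
    rw [← hKKT1, Matrix.add_mulVec, Matrix.smul_mulVec, hKxi, smul_zero, add_zero,
      Matrix.mulVec_add, Matrix.mulVec_mulVec _ Jᵀ S, hJS, Matrix.zero_mulVec, add_zero, hx,
      Matrix.mulVec_mulVec, Matrix.mulVec_mulVec, Matrix.mul_assoc]
  rw [hb, Matrix.mulVec_mulVec x, Matrix.nonsing_inv_mul _ hPD.det_pos.ne'.isUnit,
    Matrix.one_mulVec, hx]
end

section
/- Let G be a finite simple connected graph on vertex set {1, …, N} with N ≥ 2 and Laplacian matrix L, let n ≥ 1, set 𝕃 = L ⊗ I_n, let √𝕃 denote its positive semidefinite square root, and let 𝟙 = 1_N ⊗ I_n. Let 𝐆 be a real symmetric positive definite Nn×Nn matrix, μ ≥ 0 a real number, and b ∈ ℝ^{Nn}. Then there exist ξ ∈ ℝ^{Nn} and λ ∈ ℝ^{Nn} satisfying (𝐆 + μ𝕃) ξ + √𝕃 λ = b and √𝕃 ξ = 0, and any such ξ equals 𝟙 (𝟙^⊤ 𝐆 𝟙)^{-1} 𝟙^⊤ b. -/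
open Matrix Kronecker

theorem kkt_range {m k : Type*} [Fintype m] [Fintype k] [DecidableEq m] [DecidableEq k]
    (S : Matrix m m ℝ) (J : Matrix m k ℝ) (hS : Sᵀ = S)
    (hker : ∀ v, S *ᵥ v = 0 ↔ ∃ u, v = J *ᵥ u) (w : m → ℝ) (hw : Jᵀ *ᵥ w = 0) :
    ∃ x, S *ᵥ x = w := by
  have hSJ : ∀ u, S *ᵥ (J *ᵥ u) = 0 := fun u => (hker _).2 ⟨u, rfl⟩
  have hSJ' : S * J = 0 := by
    apply Matrix.ext_of_mulVec_single
    intro i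
    rw [← Matrix.mulVec_mulVec, hSJ, Matrix.zero_mulVec]
  have hJS : Jᵀ * S = 0 := by
    have := congrArg Matrix.transpose hSJ'
    rwa [Matrix.transpose_mul, hS, Matrix.transpose_zero] at this
  have key : ∀ x, Jᵀ *ᵥ ((S + J * Jᵀ) *ᵥ x) = 0 → Jᵀ *ᵥ x = 0 := by
    intro x hx
    rw [Matrix.mulVec_mulVec, Matrix.mul_add, hJS, zero_add, ← Matrix.mulVec_mulVec,
      ← Matrix.mulVec_mulVec] at hx
    have h1 : J *ᵥ (Jᵀ *ᵥ x) = 0 := by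
      rw [← dotProduct_self_eq_zero, Matrix.dotProduct_mulVec, ← Matrix.mulVec_transpose, hx,
        zero_dotProduct]
    rw [← dotProduct_self_eq_zero, Matrix.dotProduct_mulVec, ← Matrix.mulVec_transpose,
      Matrix.transpose_transpose, h1, zero_dotProduct]
  have hdet : IsUnit (S + J * Jᵀ).det := by
    rw [isUnit_iff_ne_zero]
    intro h0
    obtain ⟨x, hx0, hx⟩ := Matrix.exists_mulVec_eq_zero_iff.2 h0
    have h1 := key x (by rw [hx, Matrix.mulVec_zero])
    rw [Matrix.add_mulVec, ← Matrix.mulVec_mulVec, h1, Matrix.mulVec_zero, add_zero] at hx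
    obtain ⟨u, hu⟩ := (hker x).1 hx
    apply hx0
    rw [← dotProduct_self_eq_zero]
    nth_rewrite 2 [hu]
    rw [Matrix.dotProduct_mulVec, ← Matrix.mulVec_transpose, h1, zero_dotProduct]
  have hx : (S + J * Jᵀ) *ᵥ ((S + J * Jᵀ)⁻¹ *ᵥ w) = w := by
    rw [Matrix.mulVec_mulVec, Matrix.mul_nonsing_inv _ hdet, Matrix.one_mulVec]
  refine ⟨(S + J * Jᵀ)⁻¹ *ᵥ w, ?_⟩
  have h1 := key ((S + J * Jᵀ)⁻¹ *ᵥ w) (by rw [hx, hw])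
  rw [Matrix.add_mulVec, ← Matrix.mulVec_mulVec, h1, Matrix.mulVec_zero, add_zero] at hx
  exact hx

/-- Lemma 1: the KKT system `(G + μ𝕃) ξ + √𝕃 λ = b`, `√𝕃 ξ = 0` (with
`𝕃 = L ⊗ I_n` for the Laplacian `L` of a connected graph, `√𝕃 = S` its PSD
square root, `G ≻ 0`, `μ ≥ 0`) is solvable, and every solution satisfies
`ξ = J (Jᵀ G J)⁻¹ Jᵀ b` with `J = 1_N ⊗ I_n`. -/
theorem stmt_10 (N n : ℕ) (hN : 2 ≤ N) (hn : 1 ≤ n) (G : SimpleGraph (Fin N))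
    [DecidableRel G.Adj] (hconn : G.Connected)
    (S : Matrix (Fin N × Fin n) (Fin N × Fin n) ℝ)
    (hSpsd : S.PosSemidef)
    (hSsq : S * S = G.lapMatrix ℝ ⊗ₖ (1 : Matrix (Fin n) (Fin n) ℝ))
    (Gq : Matrix (Fin N × Fin n) (Fin N × Fin n) ℝ) (hGq : Gq.PosDef)
    (μ : ℝ) (hμ : 0 ≤ μ) (b : Fin N × Fin n → ℝ)
    (J : Matrix (Fin N × Fin n) (Fin n) ℝ)
    (hJ : J = Matrix.of fun p j => if p.2 = j then (1 : ℝ) else 0) :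
    (∃ ξ lam : Fin N × Fin n → ℝ,
        (Gq + μ • (G.lapMatrix ℝ ⊗ₖ (1 : Matrix (Fin n) (Fin n) ℝ))).mulVec ξ
            + S.mulVec lam = b ∧
          S.mulVec ξ = 0) ∧
      ∀ ξ lam : Fin N × Fin n → ℝ,
        (Gq + μ • (G.lapMatrix ℝ ⊗ₖ (1 : Matrix (Fin n) (Fin n) ℝ))).mulVec ξ
            + S.mulVec lam = b →
          S.mulVec ξ = 0 →
          ξ = J.mulVec ((Jᵀ * Gq * J)⁻¹.mulVec (Jᵀ.mulVec b)) := by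
  have hS : Sᵀ = S := by
    have := hSpsd.isHermitian.eq
    rwa [Matrix.conjTranspose_eq_transpose_of_trivial] at this
  have hJv : ∀ u p, (J *ᵥ u) p = u p.2 := by
    intro u p
    simp [hJ, Matrix.mulVec, dotProduct]
  have hLv : ∀ v : Fin N × Fin n → ℝ, ∀ i j,
      ((G.lapMatrix ℝ ⊗ₖ (1 : Matrix (Fin n) (Fin n) ℝ)) *ᵥ v) (i, j)
        = (G.lapMatrix ℝ *ᵥ (fun k => v (k, j))) i := by
    intro v i j
    simp [Matrix.mulVec, dotProduct, Fintype.sum_prod_type, Matrix.kroneckerMap_apply,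
      Matrix.one_apply]
  have i0 : Fin N := ⟨0, by omega⟩
  have hSL : ∀ v, S *ᵥ v = 0 ↔
      (G.lapMatrix ℝ ⊗ₖ (1 : Matrix (Fin n) (Fin n) ℝ)) *ᵥ v = 0 := by
    intro v
    rw [← hSsq, ← Matrix.mulVec_mulVec]
    constructor
    · intro h
      rw [h, Matrix.mulVec_zero]
    · intro h
      rw [← dotProduct_self_eq_zero, Matrix.dotProduct_mulVec, ← Matrix.mulVec_transpose, hS, h,
        zero_dotProduct]
  have hker : ∀ v, S *ᵥ v = 0 ↔ ∃ u, v = J *ᵥ u := by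
    intro v
    rw [hSL]
    constructor
    · intro h
      refine ⟨fun j => v (i0, j), ?_⟩
      funext p
      obtain ⟨i, j⟩ := p
      rw [hJv]
      have h1 : G.lapMatrix ℝ *ᵥ (fun k => v (k, j)) = 0 := by
        funext k
        rw [← hLv, h]
        rfl
      exact (G.lapMatrix_mulVec_eq_zero_iff_forall_reachable.1 h1) i i0 (hconn.preconnected i i0)
    · rintro ⟨u, rfl⟩
      funext p
      obtain ⟨i, j⟩ := p
      rw [hLv]
      have h1 : G.lapMatrix ℝ *ᵥ (fun k => (J *ᵥ u) (k, j)) = 0 := by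
        rw [G.lapMatrix_mulVec_eq_zero_iff_forall_reachable]
        intro a c _
        simp only [hJv]
      rw [h1]
      rfl
  have hinj : Function.Injective J.mulVec := by
    intro u v h
    funext j
    have := congrFun h (i0, j)
    simpa only [hJv] using this
  have hdet : IsUnit (Jᵀ * Gq * J).det := by
    have h := hGq.conjTranspose_mul_mul_same hinj
    rw [Matrix.conjTranspose_eq_transpose_of_trivial] at h
    exact isUnit_iff_ne_zero.2 h.det_pos.ne'
  have hJS : ∀ x, Jᵀ *ᵥ (S *ᵥ x) = 0 := by
    intro x
    rw [← dotProduct_self_eq_zero]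
    nth_rewrite 2 [← hS]
    rw [Matrix.dotProduct_mulVec, ← Matrix.mulVec_transpose, Matrix.transpose_transpose,
      Matrix.dotProduct_mulVec, ← Matrix.mulVec_transpose, Matrix.transpose_transpose,
      (hker _).2 ⟨_, rfl⟩, zero_dotProduct]
  constructor
  · have h0 : S *ᵥ (J *ᵥ ((Jᵀ * Gq * J)⁻¹ *ᵥ (Jᵀ *ᵥ b))) = 0 := (hker _).2 ⟨_, rfl⟩
    obtain ⟨x, hx⟩ := kkt_range S J hS hker
      (b - Gq *ᵥ (J *ᵥ ((Jᵀ * Gq * J)⁻¹ *ᵥ (Jᵀ *ᵥ b)))) (by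
        rw [Matrix.mulVec_sub, Matrix.mulVec_mulVec _ Jᵀ Gq, Matrix.mulVec_mulVec _ _ J,
          Matrix.mulVec_mulVec _ (Jᵀ * Gq * J), Matrix.mul_nonsing_inv _ hdet,
          Matrix.one_mulVec, sub_self])
    refine ⟨J *ᵥ ((Jᵀ * Gq * J)⁻¹ *ᵥ (Jᵀ *ᵥ b)), x, ?_, h0⟩
    rw [Matrix.add_mulVec, Matrix.smul_mulVec, (hSL _).1 h0, smul_zero, add_zero, hx]
    abel
  · intro ξ lam h h0
    obtain ⟨u, rfl⟩ := (hker ξ).1 h0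
    rw [Matrix.add_mulVec, Matrix.smul_mulVec, (hSL _).1 h0, smul_zero, add_zero] at h
    rw [← h, Matrix.mulVec_add, hJS, add_zero, Matrix.mulVec_mulVec _ Jᵀ Gq,
      Matrix.mulVec_mulVec _ _ J, Matrix.mulVec_mulVec _ _ (Jᵀ * Gq * J),
      Matrix.nonsing_inv_mul _ hdet, Matrix.one_mulVec]
end

section
/- Let S be a real symmetric positive definite m×m matrix, P a real symmetric positive definite k×k matrix, A a real m×n matrix, B a real m×k matrix, and v ∈ ℝ^n. Then the infimum over u ∈ ℝ^k of the quadratic function J(u) = (A v + B u)^⊤ S (A v + B u) + u^⊤ P u equals v^⊤ A^⊤ (S^{-1} + B P^{-1} B^⊤)^{-1} A v, and it is attained at u* = -(P + B^⊤ S B)^{-1} B^⊤ S A v. -/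
open Matrix

/-- Completion of squares / Woodbury: the quadratic
`J(u) = (A v + B u)ᵀ S (A v + B u) + uᵀ P u` with `S ≻ 0`, `P ≻ 0` has
minimum value `vᵀ Aᵀ (S⁻¹ + B P⁻¹ Bᵀ)⁻¹ A v`, attained at
`u* = -(P + Bᵀ S B)⁻¹ Bᵀ S A v`. -/
theorem stmt_14 (m n k : ℕ) (S : Matrix (Fin m) (Fin m) ℝ) (hS : S.PosDef)
    (P : Matrix (Fin k) (Fin k) ℝ) (hP : P.PosDef)
    (A : Matrix (Fin m) (Fin n) ℝ) (B : Matrix (Fin m) (Fin k) ℝ)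
    (v : Fin n → ℝ) :
    (∀ u : Fin k → ℝ,
        v ⬝ᵥ Aᵀ.mulVec ((S⁻¹ + B * P⁻¹ * Bᵀ)⁻¹.mulVec (A.mulVec v)) ≤
          (A.mulVec v + B.mulVec u) ⬝ᵥ S.mulVec (A.mulVec v + B.mulVec u)
            + u ⬝ᵥ P.mulVec u) ∧
      ((A.mulVec v + B.mulVec (-(P + Bᵀ * S * B)⁻¹.mulVec
            (Bᵀ.mulVec (S.mulVec (A.mulVec v))))) ⬝ᵥ
          S.mulVec (A.mulVec v + B.mulVec (-(P + Bᵀ * S * B)⁻¹.mulVec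
            (Bᵀ.mulVec (S.mulVec (A.mulVec v)))))
          + (-(P + Bᵀ * S * B)⁻¹.mulVec (Bᵀ.mulVec (S.mulVec (A.mulVec v)))) ⬝ᵥ
              P.mulVec (-(P + Bᵀ * S * B)⁻¹.mulVec
                (Bᵀ.mulVec (S.mulVec (A.mulVec v)))) =
        v ⬝ᵥ Aᵀ.mulVec ((S⁻¹ + B * P⁻¹ * Bᵀ)⁻¹.mulVec (A.mulVec v))) := by
  have hQ : (P + Bᵀ * S * B).PosDef := by
    have := hS.posSemidef.conjTranspose_mul_mul_same B
    rw [conjTranspose_eq_transpose_of_trivial] at this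
    exact hP.add_posSemidef this
  have hW : (S⁻¹ + B * P⁻¹ * Bᵀ)⁻¹ = S - S * B * (P + Bᵀ * S * B)⁻¹ * Bᵀ * S := by
    have hSS : S⁻¹⁻¹ = S := nonsing_inv_nonsing_inv _ ((isUnit_iff_isUnit_det _).1 hS.isUnit)
    have hPP : P⁻¹⁻¹ = P := nonsing_inv_nonsing_inv _ ((isUnit_iff_isUnit_det _).1 hP.isUnit)
    have := add_mul_mul_inv_eq_sub (A := S⁻¹) (U := B) (C := P⁻¹) (V := Bᵀ)
      hS.inv.isUnit hP.inv.isUnit (by rw [hSS, hPP]; exact hQ.isUnit)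
    rwa [hSS, hPP] at this
  have hSt : Sᵀ = S := by
    rw [← conjTranspose_eq_transpose_of_trivial]; exact hS.1
  have hQt : (P + Bᵀ * S * B)ᵀ = P + Bᵀ * S * B := by
    rw [← conjTranspose_eq_transpose_of_trivial]; exact hQ.1
  have key : ∀ u : Fin k → ℝ,
      (A.mulVec v + B.mulVec u) ⬝ᵥ S.mulVec (A.mulVec v + B.mulVec u) + u ⬝ᵥ P.mulVec u
      = v ⬝ᵥ Aᵀ.mulVec ((S⁻¹ + B * P⁻¹ * Bᵀ)⁻¹.mulVec (A.mulVec v))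
        + (u + (P + Bᵀ * S * B)⁻¹.mulVec (Bᵀ.mulVec (S.mulVec (A.mulVec v)))) ⬝ᵥ
          (P + Bᵀ * S * B).mulVec
            (u + (P + Bᵀ * S * B)⁻¹.mulVec (Bᵀ.mulVec (S.mulVec (A.mulVec v)))) := by
    intro u
    rw [hW]
    have e0 : ∀ y, v ⬝ᵥ Aᵀ.mulVec y = A.mulVec v ⬝ᵥ y := by
      intro y
      rw [dotProduct_mulVec, vecMul_transpose]
    rw [e0]
    generalize A.mulVec v = a
    have e1 : (S - S * B * (P + Bᵀ * S * B)⁻¹ * Bᵀ * S).mulVec a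
        = S.mulVec a - S.mulVec (B.mulVec ((P + Bᵀ * S * B)⁻¹.mulVec
          (Bᵀ.mulVec (S.mulVec a)))) := by
      simp only [sub_mulVec, mulVec_mulVec, Matrix.mul_assoc]
    have e2 : (P + Bᵀ * S * B).mulVec ((P + Bᵀ * S * B)⁻¹.mulVec
          (Bᵀ.mulVec (S.mulVec a))) = Bᵀ.mulVec (S.mulVec a) := by
      rw [mulVec_mulVec, mul_nonsing_inv _ ((isUnit_iff_isUnit_det _).1 hQ.isUnit), one_mulVec]
    rw [e1]
    generalize (P + Bᵀ * S * B)⁻¹.mulVec (Bᵀ.mulVec (S.mulVec a)) = w at *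
    have sS : ∀ x y, x ⬝ᵥ S.mulVec y = y ⬝ᵥ S.mulVec x := by
      intro x y
      rw [dotProduct_mulVec, ← mulVec_transpose, hSt, dotProduct_comm]
    have sQ : ∀ x y, x ⬝ᵥ (P + Bᵀ * S * B).mulVec y = y ⬝ᵥ (P + Bᵀ * S * B).mulVec x := by
      intro x y
      rw [dotProduct_mulVec, ← mulVec_transpose, hQt, dotProduct_comm]
    have sB : ∀ (x : Fin k → ℝ) y, x ⬝ᵥ Bᵀ.mulVec y = B.mulVec x ⬝ᵥ y := by
      intro x y
      rw [dotProduct_mulVec, vecMul_transpose]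
    have q : u ⬝ᵥ (P + Bᵀ * S * B).mulVec u
        = u ⬝ᵥ P.mulVec u + B.mulVec u ⬝ᵥ S.mulVec (B.mulVec u) := by
      rw [add_mulVec, dotProduct_add, ← mulVec_mulVec, ← mulVec_mulVec, sB]
    have e3 := sQ w u
    simp only [mulVec_add, dotProduct_add, add_dotProduct, dotProduct_sub] at *
    rw [e3, q, e2, sB, sB, sS a (B.mulVec u), sS a (B.mulVec w)]
    ring
  refine ⟨fun u => ?_, ?_⟩
  · rw [key u]
    have := hQ.posSemidef.dotProduct_mulVec_nonneg
      (u + (P + Bᵀ * S * B)⁻¹.mulVec (Bᵀ.mulVec (S.mulVec (A.mulVec v))))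
    rw [star_trivial] at this
    linarith
  · rw [key, neg_add_cancel, zero_dotProduct, add_zero]
end
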